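/- Let a ∈ 𝒮(ℝ²ⁿ), χ ∈ 𝒮(ℝⁿ) with ‖χ‖_{L²} = 1, and ψ ∈ 𝒮(ℝⁿ). Then the phase-space Weyl operator Â^W with symbol a intertwines with the standard Weyl operator â^W through T_χ: Â^W(T_χ[ψ]) = T_χ[â^W ψ], i.e. for all (x,p), (2π)^{-n} ∫_{ℝⁿ×ℝⁿ} F_σa(x₀, ξ₀) e^{i(ξ₀·x − (1/2)ξ₀·x₀)} ψ(x − x₀)·conj(χ(p)) dx₀ dξ₀ = (â^W ψ)(x)·conj(χ(p)). -/

import Mathlib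

open MeasureTheory Complex ComplexConjugate ENNReal

noncomputable section

/-- Configuration space ℝⁿ. -/
abbrev Cfg (n : ℕ) := Fin n → ℝ

/-- Phase space ℝ²ⁿ = ℝⁿ × ℝⁿ. -/
abbrev Phase (n : ℕ) := (Fin n → ℝ) × (Fin n → ℝ)

/-- Euclidean dot product on ℝⁿ. -/
def dotp (n : ℕ) (a b : Cfg n) : ℝ := ∑ i, a i * b i

/-- The symplectic Fourier transform
F_σa(x₀,ξ₀) = (2π)^{-n} ∫ a(x,ξ) e^{i(x₀·ξ − ξ₀·x)} dx dξ. -/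
def Fsig (n : ℕ) (a : Phase n → ℂ) : Phase n → ℂ :=
  fun z₀ => (((2 * Real.pi) ^ n : ℝ) : ℂ)⁻¹ *
    ∫ z : Phase n, a z *
      Complex.exp (Complex.I * ((dotp n z₀.1 z.2 - dotp n z₀.2 z.1 : ℝ) : ℂ))

/-- The standard Weyl operator â^Wψ(x) = (2π)^{-n} ∫∫ e^{iξ·(x−y)} a((x+y)/2, ξ) ψ(y) dy dξ. -/
def weylOp (n : ℕ) (a : Phase n → ℂ) (ψ : Cfg n → ℂ) : Cfg n → ℂ :=
  fun x => (((2 * Real.pi) ^ n : ℝ) : ℂ)⁻¹ *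
    ∫ y : Cfg n, ∫ ξ : Cfg n,
      Complex.exp (Complex.I * ((dotp n ξ (x - y) : ℝ) : ℂ)) *
        a ((1 / 2 : ℝ) • (x + y), ξ) * ψ y

lemma continuous_dotp (n : ℕ) : Continuous fun q : Cfg n × Cfg n => dotp n q.1 q.2 := by
  unfold dotp
  fun_prop

@[fun_prop]
lemma Continuous.dotp {X : Type*} [TopologicalSpace X] {n : ℕ} {f g : X → Cfg n}
    (hf : Continuous f) (hg : Continuous g) : Continuous fun x => dotp n (f x) (g x) :=
  (continuous_dotp n).comp (hf.prodMk hg)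

lemma dotp_sub_right (n : ℕ) (a b c : Cfg n) : dotp n a (b - c) = dotp n a b - dotp n a c := by
  simp [dotp, mul_sub, Finset.sum_sub_distrib]

lemma dotp_smul_right (n : ℕ) (r : ℝ) (a b : Cfg n) : dotp n a (r • b) = r * dotp n a b := by
  simp [dotp, Finset.mul_sum, mul_left_comm]

lemma dotp_smul_left (n : ℕ) (r : ℝ) (a b : Cfg n) : dotp n (r • a) b = r * dotp n a b := by
  simp [dotp, Finset.mul_sum, mul_assoc]

lemma dotp_comm (n : ℕ) (a b : Cfg n) : dotp n a b = dotp n b a := by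
  simp [dotp, mul_comm]

lemma norm_exp_I_mul_ofReal_eq_one (r : ℝ) : ‖Complex.exp (Complex.I * (r : ℂ))‖ = 1 := by
  rw [mul_comm, Complex.norm_exp_ofReal_mul_I]

/-- Multiplying an integrable function by a continuous unimodular phase keeps it integrable. -/
lemma MeasureTheory.Integrable.mul_exp_I_ofReal {X : Type*} [TopologicalSpace X]
    [MeasurableSpace X] [OpensMeasurableSpace X] {μ : Measure X}
    {f : X → ℂ} (hf : Integrable f μ) {θ : X → ℝ} (hθ : Continuous θ) :
    Integrable (fun x => f x * Complex.exp (Complex.I * (θ x : ℂ))) μ := by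
  refine hf.mul_bdd (c := 1) (by
    have : Continuous fun x => Complex.exp (Complex.I * (θ x : ℂ)) := by fun_prop
    exact this.aestronglyMeasurable) (.of_forall fun x => (norm_exp_I_mul_ofReal_eq_one _).le)

/-- Fourier inversion on `Fin n → ℝ` in the `e^{-iξ·u}` normalization. -/
lemma integral_integral_exp_dotp_eq {n : ℕ} {f : Cfg n → ℂ} (hc : Continuous f)
    (hf : Integrable f)
    (hF : Integrable fun ξ : Cfg n =>
      ∫ u, f u * Complex.exp (Complex.I * ((-dotp n ξ u : ℝ) : ℂ))) (y : Cfg n) :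
    ∫ ξ : Cfg n, (∫ u, f u * Complex.exp (Complex.I * ((-dotp n ξ u : ℝ) : ℂ))) *
        Complex.exp (Complex.I * ((dotp n ξ y : ℝ) : ℂ))
      = (((2 * Real.pi) ^ n : ℝ) : ℂ) * f y := by
  set G : Cfg n → ℂ := fun ξ => ∫ u, f u * Complex.exp (Complex.I * ((-dotp n ξ u : ℝ) : ℂ))
    with hG
  let g : EuclideanSpace ℝ (Fin n) → ℂ := fun v => f v.ofLp
  have hmp := PiLp.volume_preserving_ofLp (Fin n)
  have hemb : MeasurableEmbedding (WithLp.ofLp : EuclideanSpace ℝ (Fin n) → Cfg n) :=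
    (MeasurableEquiv.toLp 2 (Cfg n)).symm.measurableEmbedding
  have hinner (v w : EuclideanSpace ℝ (Fin n)) : inner ℝ v w = dotp n w.ofLp v.ofLp := by
    simp [dotp, PiLp.inner_apply]
  have hgF (w : EuclideanSpace ℝ (Fin n)) : FourierTransform.fourier g w = G ((2 * Real.pi) • w.ofLp) := by
    simp only [Real.fourier_eq', hG]
    rw [← hmp.integral_comp hemb]
    refine integral_congr_ae (.of_forall fun v => ?_)
    simp only [hinner, g, dotp_smul_left, smul_eq_mul]
    rw [mul_comm]
    congr 2
    push_cast
    ring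
  have hpi : (2 * Real.pi) ≠ 0 := by positivity
  have hgi : Integrable g := (hmp.integrable_comp_emb hemb).2 hf
  have hgFi : Integrable (FourierTransform.fourier g) := by
    have : FourierTransform.fourier g = (fun w : Cfg n => G ((2 * Real.pi) • w)) ∘ WithLp.ofLp :=
      funext hgF
    rw [this, hmp.integrable_comp_emb hemb]
    exact hF.comp_smul hpi
  have hgc : Continuous g := hc.comp (PiLp.continuous_ofLp 2 _)
  have key := hgi.fourierInv_fourier_eq hgFi (v := WithLp.toLp 2 y) hgc.continuousAt
  rw [Real.fourierInv_eq'] at key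
  have h1 : ∫ w : Cfg n, G ((2 * Real.pi) • w) *
      Complex.exp (Complex.I * ((dotp n ((2 * Real.pi) • w) y : ℝ) : ℂ)) = f y := by
    rw [← hmp.integral_comp hemb]
    refine Eq.trans (integral_congr_ae (.of_forall fun v => ?_)) key
    simp only [hinner, hgF, dotp_smul_left, smul_eq_mul]
    rw [mul_comm, dotp_comm, mul_comm Complex.I]
  rw [Measure.integral_comp_smul volume
    (fun ξ => G ξ * Complex.exp (Complex.I * ((dotp n ξ y : ℝ) : ℂ)))] at h1
  rw [← h1, Module.finrank_fin_fun, abs_of_pos (by positivity), Complex.real_smul, ← mul_assoc,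
    ← Complex.ofReal_mul, mul_inv_cancel₀ (pow_ne_zero _ hpi), Complex.ofReal_one, one_mul]

/-- Phase space as a Euclidean space. -/
def phaseEquiv (n : ℕ) : EuclideanSpace ℝ (Fin n ⊕ Fin n) ≃L[ℝ] Phase n :=
  ((WithLp.linearEquiv 2 ℝ (Fin n ⊕ Fin n → ℝ)).trans
    (LinearEquiv.sumArrowLequivProdArrow (Fin n) (Fin n) ℝ ℝ)).toContinuousLinearEquiv

lemma phaseEquiv_apply (n : ℕ) (v : EuclideanSpace ℝ (Fin n ⊕ Fin n)) :
    phaseEquiv n v = (fun i => v (Sum.inl i), fun i => v (Sum.inr i)) := rfl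

lemma measurePreserving_phaseEquiv (n : ℕ) : MeasurePreserving (phaseEquiv n) :=
  (volume_measurePreserving_sumPiEquivProdPi (fun _ : Fin n ⊕ Fin n => ℝ)).comp
    (PiLp.volume_preserving_ofLp (Fin n ⊕ Fin n))

/-- The linear map `(x₀, ξ₀) ↦ (ξ₀, -x₀)` rescaled by `1 / 2π`. -/
def symplecticEquiv (n : ℕ) : Phase n ≃L[ℝ] Phase n :=
  (LinearEquiv.ofLinearMap
    (((2 * Real.pi)⁻¹ • LinearMap.snd ℝ (Cfg n) (Cfg n)).prod
      (-(2 * Real.pi)⁻¹ • LinearMap.fst ℝ (Cfg n) (Cfg n)))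
    ((-(2 * Real.pi) • LinearMap.snd ℝ (Cfg n) (Cfg n)).prod
      ((2 * Real.pi) • LinearMap.fst ℝ (Cfg n) (Cfg n)))
    (by
      have := Real.pi_ne_zero
      ext <;> simp <;> field_simp)
    (by
      have := Real.pi_ne_zero
      ext <;> simp <;> field_simp)).toContinuousLinearEquiv

lemma symplecticEquiv_apply (n : ℕ) (z : Phase n) :
    symplecticEquiv n z = ((2 * Real.pi)⁻¹ • z.2, (-(2 * Real.pi)⁻¹) • z.1) := rfl

lemma SchwartzMap.integrable_phase {n : ℕ} (f : SchwartzMap (Phase n) ℂ) : Integrable f := by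
  have : (volume : Measure (Phase n)).IsAddHaarMeasure :=
    Measure.prod.instIsAddHaarMeasure (volume : Measure (Cfg n)) (volume : Measure (Cfg n))
  exact f.integrable

/-- The symplectic Fourier transform of a Schwartz function is integrable. -/
lemma integrable_Fsig (n : ℕ) (a : SchwartzMap (Phase n) ℂ) : Integrable (Fsig n a) := by
  let b : SchwartzMap (EuclideanSpace ℝ (Fin n ⊕ Fin n)) ℂ :=
    SchwartzMap.compCLMOfContinuousLinearEquiv ℂ (phaseEquiv n) a
  let h : SchwartzMap (Phase n) ℂ :=
    SchwartzMap.compCLMOfContinuousLinearEquiv ℂ ((symplecticEquiv n).trans (phaseEquiv n).symm)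
      (FourierTransform.fourier b)
  have hb (v) : b v = a (phaseEquiv n v) := rfl
  have hh (z) : h z =
      FourierTransform.fourier (b : _ → ℂ) ((phaseEquiv n).symm (symplecticEquiv n z)) := rfl
  have hemb : MeasurableEmbedding (phaseEquiv n) :=
    (phaseEquiv n).toHomeomorph.measurableEmbedding
  have hinner (v w : EuclideanSpace ℝ (Fin n ⊕ Fin n)) : inner ℝ v w =
      dotp n (phaseEquiv n w).1 (phaseEquiv n v).1 +
        dotp n (phaseEquiv n w).2 (phaseEquiv n v).2 := by
    simp [dotp, PiLp.inner_apply, phaseEquiv_apply]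
  have hpi := Real.pi_ne_zero
  have : Fsig n a = fun z => (((2 * Real.pi) ^ n : ℝ) : ℂ)⁻¹ * h z := by
    funext z
    rw [Fsig, hh, Real.fourier_eq', ← (measurePreserving_phaseEquiv n).integral_comp hemb]
    congr 1
    refine integral_congr_ae (.of_forall fun v => ?_)
    simp only [hinner, hb, ContinuousLinearEquiv.apply_symm_apply, symplecticEquiv_apply,
      dotp_smul_left, smul_eq_mul]
    rw [mul_comm, mul_comm Complex.I]
    congr 4
    field_simp
    ring
  rw [this]
  exact h.integrable_phase.const_mul _

/-- The partial Fourier transform of `a` in the momentum variable. -/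
def partialFourier (n : ℕ) (a : Phase n → ℂ) (x₀ u : Cfg n) : ℂ :=
  ∫ v : Cfg n, a (u, v) * Complex.exp (Complex.I * ((dotp n x₀ v : ℝ) : ℂ))

lemma continuous_partialFourier (n : ℕ) (a : SchwartzMap (Phase n) ℂ) (x₀ : Cfg n) :
    Continuous (partialFourier n a x₀) := by
  set C : ℝ := 2 ^ (n + 1) *
    ((Finset.Iic (n + 1, 0)).sup fun m => SchwartzMap.seminorm ℝ m.1 m.2) a
  have ha := a.continuous
  refine continuous_of_dominated (bound := fun v => C * (1 + ‖v‖) ^ (-((n + 1 : ℕ) : ℝ)))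
    (fun u => ?_) (fun u => .of_forall fun v => ?_) ?_ (.of_forall fun v => ?_)
  · exact Continuous.aestronglyMeasurable (by fun_prop)
  · rw [norm_mul, norm_exp_I_mul_ofReal_eq_one, mul_one, Real.rpow_neg (by positivity),
      Real.rpow_natCast, ← div_eq_mul_inv, le_div_iff₀ (by positivity), mul_comm]
    have h := SchwartzMap.one_add_le_sup_seminorm_apply (𝕜 := ℝ) (m := (n + 1, 0))
      (le_refl (n + 1)) le_rfl a (u, v)
    rw [norm_iteratedFDeriv_zero] at h
    refine le_trans ?_ h
    gcongr
    exact le_max_right _ _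
  · exact (integrable_one_add_norm (by simp)).const_mul _
  · fun_prop

lemma integrable_mul_exp_dotp (n : ℕ) (a : SchwartzMap (Phase n) ℂ) (x₀ : Cfg n) :
    Integrable fun z : Phase n =>
      a z * Complex.exp (Complex.I * ((dotp n x₀ z.2 : ℝ) : ℂ)) :=
  a.integrable_phase.mul_exp_I_ofReal (by fun_prop)

lemma integrable_partialFourier (n : ℕ) (a : SchwartzMap (Phase n) ℂ) (x₀ : Cfg n) :
    Integrable (partialFourier n a x₀) :=
  (integrable_mul_exp_dotp n a x₀).integral_prod_left

lemma Fsig_eq_integral_partialFourier (n : ℕ) (a : SchwartzMap (Phase n) ℂ) (x₀ ξ₀ : Cfg n) :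
    Fsig n a (x₀, ξ₀) = (((2 * Real.pi) ^ n : ℝ) : ℂ)⁻¹ *
      ∫ u, partialFourier n a x₀ u * Complex.exp (Complex.I * ((-dotp n ξ₀ u : ℝ) : ℂ)) := by
  have hint : Integrable fun z : Phase n => a z *
      Complex.exp (Complex.I * ((dotp n x₀ z.2 - dotp n ξ₀ z.1 : ℝ) : ℂ)) :=
    a.integrable_phase.mul_exp_I_ofReal (by fun_prop)
  rw [Fsig]
  congr 1
  refine (integral_prod _ hint).trans (integral_congr_ae (.of_forall fun u => ?_))
  simp only [partialFourier]
  rw [← integral_mul_const]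
  refine integral_congr_ae (.of_forall fun v => ?_)
  simp only
  rw [mul_assoc, ← Complex.exp_add]
  congr 2
  push_cast
  ring

/-- Inverting the symplectic Fourier transform in the momentum variable only. -/
lemma integral_Fsig_mul_exp (n : ℕ) (a : SchwartzMap (Phase n) ℂ) {x₀ : Cfg n}
    (h : Integrable fun ξ₀ => Fsig n a (x₀, ξ₀)) (y : Cfg n) :
    ∫ ξ₀, Fsig n a (x₀, ξ₀) * Complex.exp (Complex.I * ((dotp n ξ₀ y : ℝ) : ℂ))
      = partialFourier n a x₀ y := by
  have hc : (((2 * Real.pi) ^ n : ℝ) : ℂ) ≠ 0 := by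
    exact_mod_cast (by positivity : (2 * Real.pi) ^ n ≠ 0)
  simp only [Fsig_eq_integral_partialFourier] at h ⊢
  have h' := (integrable_const_mul_iff (isUnit_iff_ne_zero.2 (inv_ne_zero hc)) _).1 h
  simp only [mul_assoc]
  rw [integral_const_mul, integral_integral_exp_dotp_eq (continuous_partialFourier n a x₀)
    (integrable_partialFourier n a x₀) h', inv_mul_cancel_left₀ hc]

/-- Intertwining: the phase-space Weyl operator Â^W with symbol a satisfies
Â^W(T_χ[ψ]) = T_χ[â^W ψ] for Schwartz a, ψ and Schwartz χ with ‖χ‖_{L²} = 1. -/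
theorem phase_space_Weyl_intertwines (n : ℕ)
    (a : SchwartzMap (Phase n) ℂ) (χ ψ : SchwartzMap (Cfg n) ℂ)
    (hnorm : ∫ p : Cfg n, ‖χ p‖ ^ 2 = 1) :
    ∀ x p : Cfg n,
      (((2 * Real.pi) ^ n : ℝ) : ℂ)⁻¹ *
        ∫ z₀ : Phase n, Fsig n (⇑a) z₀ *
          Complex.exp (Complex.I * ((dotp n z₀.2 x - dotp n z₀.2 z₀.1 / 2 : ℝ) : ℂ)) *
          (ψ (x - z₀.1) * conj (χ p))
      = weylOp n (⇑a) (⇑ψ) x * conj (χ p) := by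
  intro x p
  have hψ : Continuous fun z₀ : Phase n => ψ (x - z₀.1) * conj (χ p) := by
    have := ψ.continuous
    fun_prop
  obtain ⟨C, hC⟩ : ∃ C, ∀ y, ‖ψ y‖ ≤ C :=
    ⟨_, fun y => SchwartzMap.norm_le_seminorm ℝ ψ y⟩
  have hint : Integrable fun z₀ : Phase n => Fsig n (⇑a) z₀ *
      Complex.exp (Complex.I * ((dotp n z₀.2 x - dotp n z₀.2 z₀.1 / 2 : ℝ) : ℂ)) *
      (ψ (x - z₀.1) * conj (χ p)) := by
    refine ((integrable_Fsig n a).mul_exp_I_ofReal (by fun_prop)).mul_bdd (c := C * ‖χ p‖)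
      hψ.aestronglyMeasurable (.of_forall fun z => ?_)
    rw [norm_mul, RCLike.norm_conj]
    gcongr
    exact hC _
  have hinner : ∀ᵐ x₀ : Cfg n, ∫ ξ₀ : Cfg n, Fsig n (⇑a) (x₀, ξ₀) *
      Complex.exp (Complex.I * ((dotp n ξ₀ x - dotp n ξ₀ x₀ / 2 : ℝ) : ℂ)) *
      (ψ (x - x₀) * conj (χ p)) =
      partialFourier n a x₀ (x - (1 / 2 : ℝ) • x₀) * (ψ (x - x₀) * conj (χ p)) := by
    filter_upwards [(integrable_Fsig n a).prod_right_ae] with x₀ hx₀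
    rw [integral_mul_const, ← integral_Fsig_mul_exp n a hx₀]
    simp only [dotp_sub_right, dotp_smul_right, one_div_mul_eq_div]
  rw [Measure.volume_eq_prod, integral_prod _ hint, integral_congr_ae hinner, weylOp, mul_assoc,
    ← integral_mul_const]
  congr 1
  refine (integral_sub_left_eq_self (fun x₀ : Cfg n => partialFourier n a x₀
    (x - (1 / 2 : ℝ) • x₀) * (ψ (x - x₀) * conj (χ p))) volume x).symm.trans ?_
  refine integral_congr_ae (.of_forall fun y => ?_)
  simp only [_root_.sub_sub_cancel, partialFourier]
  rw [integral_mul_const, mul_assoc]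
  congr 1
  refine integral_congr_ae (.of_forall fun v => ?_)
  have hmid : x - (1 / 2 : ℝ) • (x - y) = (1 / 2 : ℝ) • (x + y) := by
    module
  simp only [hmid]
  rw [mul_comm, dotp_comm]
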